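/- For every ℓ ≥ 6, the projective dimension of the S-module D(A(C_ℓ^C)) equals 2, where C_ℓ^C is the complement of the cycle graph on ℓ vertices (the ℓ-antihole). -/

import Mathlib

open MvPolynomial CategoryTheory

/-- The polynomial ring `S = ℚ[x_1, …, x_ℓ]` (variables indexed by `Fin ℓ`). -/
abbrev Spoly (ℓ : ℕ) : Type := MvPolynomial (Fin ℓ) ℚ

/-- The module `D(A(G))` of logarithmic derivations of the graphic arrangement of a
graph `G` on the vertex set `{1, …, ℓ}`: all `θ ∈ Der_ℚ(S)` such that `(x_i - x_j)`
divides `θ(x_i) - θ(x_j)` for every edge `{i, j}` of `G`. -/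
noncomputable def logDer (ℓ : ℕ) (G : SimpleGraph (Fin ℓ)) :
    Submodule (Spoly ℓ) (Derivation ℚ (Spoly ℓ) (Spoly ℓ)) where
  carrier := {θ | ∀ i j : Fin ℓ, G.Adj i j → (X i - X j) ∣ θ (X i) - θ (X j)}
  add_mem' := by
    intro a b ha hb i j h
    have : (a + b) (X i) - (a + b) (X j)
        = (a (X i) - a (X j)) + (b (X i) - b (X j)) := by
      simp only [Derivation.add_apply]; ring
    rw [this]
    exact dvd_add (ha i j h) (hb i j h)
  zero_mem' := by intro i j h; simp
  smul_mem' := by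
    intro c θ hθ i j h
    have : (c • θ) (X i) - (c • θ) (X j) = c * (θ (X i) - θ (X j)) := by
      simp only [Derivation.smul_apply, smul_eq_mul]; ring
    rw [this]
    exact (hθ i j h).mul_left c

/-- `pdLE M n` : `M` admits a projective resolution vanishing in homological
degrees above `n`, i.e. the projective dimension of `M` is at most `n`. -/
def pdLE {R : Type} [CommRing R] (M : ModuleCat R) (n : ℕ) : Prop :=
  ∃ P : ProjectiveResolution M, ∀ i : ℕ, n < i → Limits.IsZero (P.complex.X i)

/-- The projective dimension of a module, as an element of `ℕ∞`
(infimum of the lengths of projective resolutions; `⊤` if there is none of finite length). -/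
noncomputable def pd {R : Type} [CommRing R] (M : ModuleCat R) : ℕ∞ :=
  sInf {n : ℕ∞ | ∃ k : ℕ, (k : ℕ∞) = n ∧ pdLE M k}

section Homological

variable {R : Type} [CommRing R]

lemma pdLE_mono {M : ModuleCat R} {m n : ℕ} (h : m ≤ n) (hM : pdLE M m) : pdLE M n :=
  let ⟨P, hP⟩ := hM
  ⟨P, fun i hi => hP i (h.trans_lt hi)⟩

lemma pdLE_zero_of_projective (M : ModuleCat R) [Projective M] : pdLE M 0 :=
  ⟨ProjectiveResolution.self M, fun i hi =>
    HomologicalComplex.isZero_single_obj_X _ _ _ _ (by simpa using hi.ne')⟩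

lemma pdLE_succ_of_shortExact {T : ShortComplex (ModuleCat R)} (hT : T.ShortExact)
    [Projective T.X₂] {n : ℕ} (h : pdLE T.X₁ n) : pdLE T.X₃ (n + 1) := by
  obtain ⟨P, hP⟩ := h
  have := hT.mono_f
  have := hT.epi_g
  obtain ⟨π, _, hπ, hex⟩ : ∃ π : P.complex.X 0 ⟶ T.X₁, Epi π ∧
      ∃ w : P.complex.d 1 0 ≫ π = 0, (ShortComplex.mk _ π w).Exact :=
    ⟨P.π.f 0, inferInstanceAs (Epi (P.π.f 0)), P.complex_d_comp_π_f_zero, P.exact₀⟩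
  have w : P.complex.d 1 0 ≫ π ≫ T.f = 0 := by
    rw [← Category.assoc, hπ, Limits.zero_comp]
  have w' : (π ≫ T.f) ≫ T.g = 0 := by
    rw [Category.assoc, T.zero, Limits.comp_zero]
  let C := ChainComplex.augment P.complex (π ≫ T.f) w
  have h0 : (ShortComplex.mk (π ≫ T.f) T.g w').Exact := by
    let α : ShortComplex.mk (π ≫ T.f) T.g w' ⟶ T :=
      { τ₁ := π
        τ₂ := 𝟙 _
        τ₃ := 𝟙 _
        comm₁₂ := (Category.comp_id _).symm
        comm₂₃ := (Category.id_comp _).trans (Category.comp_id _).symm }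
    have : Epi α.τ₁ := inferInstanceAs (Epi π)
    have : IsIso α.τ₂ := inferInstanceAs (IsIso (𝟙 T.X₂))
    have : Mono α.τ₃ := inferInstanceAs (Mono (𝟙 T.X₃))
    rw [ShortComplex.exact_iff_of_epi_of_isIso_of_mono α]
    exact hT.exact
  have h1 : (ShortComplex.mk (P.complex.d 1 0) (π ≫ T.f) w).Exact := by
    let α : ShortComplex.mk (P.complex.d 1 0) π hπ ⟶
        ShortComplex.mk (P.complex.d 1 0) (π ≫ T.f) w :=
      { τ₁ := 𝟙 _
        τ₂ := 𝟙 _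
        τ₃ := T.f
        comm₁₂ := (Category.id_comp _).trans (Category.comp_id _).symm
        comm₂₃ := Category.id_comp _ }
    have : Epi α.τ₁ := inferInstanceAs (Epi (𝟙 (P.complex.X 1)))
    have : IsIso α.τ₂ := inferInstanceAs (IsIso (𝟙 (P.complex.X 0)))
    have : Mono α.τ₃ := inferInstanceAs (Mono T.f)
    rw [← ShortComplex.exact_iff_of_epi_of_isIso_of_mono α]
    exact hex
  have hC : ∀ i, C.ExactAt (i + 1) := by
    intro i
    rw [HomologicalComplex.exactAt_iff' _ (i + 2) (i + 1) i (by simp) (by simp)]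
    match i with
    | 0 => exact h1
    | i + 1 => exact P.exact_succ i
  refine ⟨{ complex := C
            projective := ?_
            π := (ChainComplex.toSingle₀Equiv _ _).symm ⟨T.g, w'⟩
            quasiIso := ⟨fun i => ?_⟩ }, ?_⟩
  · rintro (_ | i)
    · assumption
    · exact P.projective i
  · cases i
    · rw [ChainComplex.quasiIsoAt₀_iff, ShortComplex.quasiIso_iff_of_zeros']
      · refine (ShortComplex.exact_and_epi_g_iff_of_iso ?_).2 ⟨h0, hT.epi_g⟩
        exact ShortComplex.isoMk (Iso.refl _) (Iso.refl _) (Iso.refl _)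
          ((Category.id_comp _).trans (Category.comp_id _).symm)
          ((Category.id_comp _).trans (Category.comp_id _).symm)
      all_goals rfl
    · rw [quasiIsoAt_iff_exactAt']
      · apply hC
      · apply ChainComplex.exactAt_succ_single_obj
  · rintro (_ | i) hi
    · simp at hi
    · exact hP i (by omega)

lemma hasProjectiveDimensionLT_two_of_pdLE_one {M : ModuleCat R} (h : pdLE M 1) :
    HasProjectiveDimensionLT M 2 := by
  obtain ⟨P, hP⟩ := h
  let T := ShortComplex.mk (P.complex.d 1 0) (P.π.f 0) P.complex_d_comp_π_f_zero
  have hT : T.ShortExact :=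
    { exact := P.exact₀
      mono_f := (ShortComplex.exact_iff_mono _ ((hP 2 one_lt_two).eq_of_src _ _)).1 (P.exact_succ 0)
      epi_g := inferInstanceAs (Epi (P.π.f 0)) }
  have : Projective T.X₁ := P.projective 1
  have : Projective T.X₂ := P.projective 0
  exact hT.hasProjectiveDimensionLT_X₃ 1 inferInstance inferInstance

/-- A module whose first syzygy has a free resolution of length one, but is not projective,
has projective dimension two. -/
lemma pd_eq_two_of_exact {F₀ F₁ F₂ N M : Type} [AddCommGroup F₀] [AddCommGroup F₁] [AddCommGroup F₂]
    [AddCommGroup N] [AddCommGroup M]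
    [Module R F₀] [Module R F₁] [Module R F₂] [Module R N] [Module R M]
    [Module.Projective R F₀] [Module.Projective R F₁] [Module.Projective R F₂]
    (d₂ : F₂ →ₗ[R] F₁) (p : F₁ →ₗ[R] N) (d₁ : N →ₗ[R] F₀) (e : F₀ →ₗ[R] M)
    (hd₂ : Function.Injective d₂) (hp : Function.Surjective p) (h₁ : Function.Exact d₂ p)
    (hd₁ : Function.Injective d₁) (he : Function.Surjective e) (h₀ : Function.Exact d₁ e)
    (hns : ¬ ∃ r : F₁ →ₗ[R] F₂, r ∘ₗ d₂ = LinearMap.id) :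
    pd (ModuleCat.of R M) = 2 := by
  let A := ShortComplex.mk (ModuleCat.ofHom d₂) (ModuleCat.ofHom p)
    (by ext x; exact h₁.apply_apply_eq_zero x)
  let B := ShortComplex.mk (ModuleCat.ofHom d₁) (ModuleCat.ofHom e)
    (by ext x; exact h₀.apply_apply_eq_zero x)
  have hA : A.ShortExact := ModuleCat.shortComplex_shortExact _ h₁ hd₂ hp
  have hB : B.ShortExact := ModuleCat.shortComplex_shortExact _ h₀ hd₁ he
  have : Projective A.X₁ := (IsProjective.iff_projective (P := F₂)).1 ‹_›
  have : Projective A.X₂ := (IsProjective.iff_projective (P := F₁)).1 ‹_›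
  have : Projective B.X₂ := (IsProjective.iff_projective (P := F₀)).1 ‹_›
  have hle : pdLE (ModuleCat.of R M) 2 :=
    pdLE_succ_of_shortExact hB (pdLE_succ_of_shortExact hA (pdLE_zero_of_projective A.X₁))
  have hnot : ¬ pdLE (ModuleCat.of R M) 1 := by
    intro h
    have h3 : HasProjectiveDimensionLT B.X₃ 2 := hasProjectiveDimensionLT_two_of_pdLE_one h
    have h1 : HasProjectiveDimensionLT B.X₁ 1 :=
      hB.hasProjectiveDimensionLT_X₁ 1 inferInstance inferInstance
    have : Projective (ModuleCat.of R N) := projective_iff_hasProjectiveDimensionLT_one.2 h1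
    have : Module.Projective R N := (IsProjective.iff_projective (P := N)).2 this
    obtain ⟨s, hs⟩ := Module.projective_lifting_property p LinearMap.id hp
    exact hns (((h₁.split_tfae').out 0 1 rfl rfl).1 ⟨hd₂, s, hs⟩).2
  refine le_antisymm (sInf_le ⟨2, rfl, hle⟩) (le_sInf ?_)
  rintro _ ⟨k, rfl, hk⟩
  by_contra! hlt
  have : k < 2 := by exact_mod_cast hlt
  exact hnot (pdLE_mono (by omega) hk)

end Homological

section Merge

variable {ι : Type}

lemma sub_rename_mem_span (τ : ι → ι) (f : MvPolynomial ι ℚ) :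
    f - rename τ f ∈ Ideal.span (Set.range fun i => (X i - X (τ i) : MvPolynomial ι ℚ)) := by
  induction f using MvPolynomial.induction_on with
  | C a => simp
  | add p q hp hq =>
    have : p + q - rename τ (p + q) = (p - rename τ p) + (q - rename τ q) := by
      rw [map_add]; ring
    rw [this]
    exact add_mem hp hq
  | mul_X p i hp =>
    have : p * X i - rename τ (p * X i) =
        X i * (p - rename τ p) + rename τ p * (X i - X (τ i)) := by
      rw [map_mul, rename_X]; ring
    rw [this]
    exact add_mem (Ideal.mul_mem_left _ _ hp)
      (Ideal.mul_mem_left _ _ (Ideal.subset_span ⟨i, rfl⟩))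

lemma X_sub_X_ne_zero {i j : ι} (h : i ≠ j) : (X i - X j : MvPolynomial ι ℚ) ≠ 0 :=
  sub_ne_zero.2 fun e => h (X_injective e)

variable [DecidableEq ι]

/-- The map of index sets sending `j` to `i` and fixing everything else. -/
def merge (i j : ι) : ι → ι := Function.update id j i

lemma merge_self (i j : ι) : merge i j j = i := by simp [merge]

lemma merge_of_ne {i j k : ι} (h : k ≠ j) : merge i j k = k := by simp [merge, h]

lemma merge_left (i j : ι) : merge i j i = i := by
  by_cases h : i = j <;> simp [merge, h]

lemma rename_merge_idem (i j : ι) (f : MvPolynomial ι ℚ) :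
    rename (merge i j) (rename (merge i j) f) = rename (merge i j) f := by
  rw [rename_rename]
  congr 2
  funext k
  by_cases hk : k = j
  · subst hk; simp [merge_self, merge_left]
  · simp [merge_of_ne hk]

lemma X_sub_X_dvd_iff {i j : ι} {f : MvPolynomial ι ℚ} :
    (X i - X j) ∣ f ↔ rename (merge i j) f = 0 := by
  constructor
  · rintro ⟨g, rfl⟩
    simp [merge_self, merge_left]
  · intro h
    have := sub_rename_mem_span (merge i j) f
    rw [h, sub_zero] at this
    rw [← Ideal.mem_span_singleton]
    refine Ideal.span_le.2 ?_ this
    rintro _ ⟨k, rfl⟩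
    dsimp only
    by_cases hk : k = j
    · subst hk
      rw [merge_self, SetLike.mem_coe, Ideal.mem_span_singleton]
      exact ⟨-1, by ring⟩
    · simp [merge_of_ne hk]

lemma prime_X_sub_X {i j : ι} (h : i ≠ j) : Prime (X i - X j : MvPolynomial ι ℚ) := by
  refine ⟨X_sub_X_ne_zero h, fun hu => ?_, fun a b hab => ?_⟩
  · have := hu.map (constantCoeff (σ := ι) (R := ℚ))
    simp at this
  · simpa only [X_sub_X_dvd_iff, map_mul, mul_eq_zero] using hab

lemma X_sub_X_dvd_of_mul_left {i j : ι} {a b : MvPolynomial ι ℚ} (h : i ≠ j)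
    (ha : ¬ (X i - X j) ∣ a) (hab : (X i - X j) ∣ a * b) : (X i - X j) ∣ b :=
  ((prime_X_sub_X h).dvd_or_dvd hab).resolve_left ha

lemma not_X_sub_X_dvd {i j k l : ι} (hkl : merge i j k ≠ merge i j l) :
    ¬ (X i - X j : MvPolynomial ι ℚ) ∣ X k - X l := by
  rw [X_sub_X_dvd_iff, map_sub, rename_X, rename_X]
  exact X_sub_X_ne_zero hkl

lemma prod_X_sub_X_dvd {i : ι} {s : Finset ι} (hi : i ∉ s) {f : MvPolynomial ι ℚ}
    (h : ∀ j ∈ s, (X i - X j) ∣ f) : (∏ j ∈ s, (X i - X j)) ∣ f := by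
  refine Finset.prod_dvd_of_isRelPrime (fun j hj k hk hjk => ?_) h
  have hij : i ≠ j := by rintro rfl; exact hi hj
  refine ((prime_X_sub_X hij).irreducible.isRelPrime_iff_not_dvd).2 (not_X_sub_X_dvd ?_)
  rw [merge_left, merge_of_ne hjk.symm]
  rintro rfl
  exact hi hk

/-- The map of index sets sending `j` and `k` to `i` and fixing everything else. -/
def mergeTwo (i j k : ι) : ι → ι := Function.update (Function.update id j i) k i

lemma mergeTwo_left (i j k : ι) : mergeTwo i j k j = i := by
  by_cases h : j = k <;> simp [mergeTwo, h]

lemma mergeTwo_right (i j k : ι) : mergeTwo i j k k = i := by simp [mergeTwo]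

lemma mergeTwo_of_ne {i j k l : ι} (hj : l ≠ j) (hk : l ≠ k) : mergeTwo i j k l = l := by
  simp [mergeTwo, hj, hk]

lemma mergeTwo_self (i j k : ι) : mergeTwo i j k i = i := by
  simp [mergeTwo, Function.update_apply]

lemma exists_of_rename_mergeTwo_eq_zero {i j k : ι} {f : MvPolynomial ι ℚ}
    (h : rename (mergeTwo i j k) f = 0) :
    ∃ u v, f = (X i - X k) * u + (X j - X i) * v := by
  have := sub_rename_mem_span (mergeTwo i j k) f
  rw [h, sub_zero] at this
  have key : f ∈ Ideal.span {(X i - X k : MvPolynomial ι ℚ), X j - X i} := by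
    refine Ideal.span_le.2 ?_ this
    rintro _ ⟨l, rfl⟩
    dsimp only
    by_cases hk : l = k
    · subst hk
      rw [mergeTwo_right, ← neg_sub (X i) (X l)]
      exact neg_mem (Ideal.subset_span (by simp))
    · by_cases hj : l = j
      · subst hj
        rw [mergeTwo_left]
        exact Ideal.subset_span (by simp)
      · simp [mergeTwo_of_ne hj hk]
  obtain ⟨u, v, huv⟩ := Ideal.mem_span_pair.1 key
  exact ⟨u, v, by rw [← huv]; ring⟩

lemma rename_mergeTwo_idem (i j k : ι) (f : MvPolynomial ι ℚ) :
    rename (mergeTwo i j k) (rename (mergeTwo i j k) f) = rename (mergeTwo i j k) f := by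
  rw [rename_rename]
  congr 2
  funext l
  by_cases hk : l = k
  · subst hk; simp [mergeTwo_right, mergeTwo_self]
  · by_cases hj : l = j
    · subst hj; simp [mergeTwo_left, mergeTwo_self]
    · simp [mergeTwo_of_ne hj hk]

variable [Fintype ι]

/-- The product of all linear forms `x_i - x_j` with `j` outside of `s`. -/
noncomputable def coProd (s : Finset ι) (i : ι) : MvPolynomial ι ℚ := ∏ j ∈ sᶜ, (X i - X j)

lemma coProd_ne_zero {s : Finset ι} {i : ι} (hi : i ∈ s) : coProd s i ≠ 0 := by
  refine Finset.prod_ne_zero_iff.2 fun j hj => X_sub_X_ne_zero ?_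
  rintro rfl
  exact (Finset.mem_compl.1 hj) hi

lemma coProd_eq_mul {s : Finset ι} {j : ι} (hj : j ∉ s) (i : ι) :
    coProd s i = (X i - X j) * coProd (insert j s) i := by
  rw [coProd, coProd, Finset.compl_insert,
    Finset.mul_prod_erase _ (fun j => (X i - X j : MvPolynomial ι ℚ)) (Finset.mem_compl.2 hj)]

lemma rename_coProd {s : Finset ι} {τ : ι → ι} (h : ∀ j ∉ s, τ j = j) (i : ι) :
    rename τ (coProd s i) = coProd s (τ i) := by
  rw [coProd, coProd, map_prod]
  refine Finset.prod_congr rfl fun j hj => ?_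
  rw [map_sub, rename_X, rename_X, h j (Finset.mem_compl.1 hj)]

lemma X_sub_X_dvd_coProd {s : Finset ι} {j : ι} (hj : j ∉ s) (i : ι) :
    (X i - X j) ∣ coProd s i :=
  ⟨_, coProd_eq_mul hj i⟩

end Merge

section Splines

variable {ι : Type}

/-- The coefficient vectors of the logarithmic derivations of the graphic arrangement of `G`. -/
def splines (G : SimpleGraph ι) :
    Submodule (MvPolynomial ι ℚ) (ι → MvPolynomial ι ℚ) where
  carrier := {f | ∀ i j, G.Adj i j → (X i - X j) ∣ f i - f j}
  add_mem' {f g} hf hg i j h := by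
    have : (f + g) i - (f + g) j = (f i - f j) + (g i - g j) := by
      simp only [Pi.add_apply]; ring
    rw [this]
    exact dvd_add (hf i j h) (hg i j h)
  zero_mem' i j h := by simp
  smul_mem' c f hf i j h := by
    have : (c • f) i - (c • f) j = c * (f i - f j) := by
      simp only [Pi.smul_apply, smul_eq_mul]; ring
    rw [this]
    exact (hf i j h).mul_left c

lemma splines_mono {G H : SimpleGraph ι} (h : G ≤ H) : splines H ≤ splines G :=
  fun _ hf i j hij => hf i j (h hij)

lemma exists_interpolation [DecidableEq ι] {f : ι → MvPolynomial ι ℚ}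
    (hf : f ∈ splines (⊤ : SimpleGraph ι)) (s : Finset ι) :
    ∃ c ∈ Polynomial.degreeLT (MvPolynomial ι ℚ) s.card, ∀ i ∈ s, c.eval (X i) = f i := by
  induction s using Finset.induction_on with
  | empty => exact ⟨0, zero_mem _, by simp⟩
  | insert k s hk ih =>
    obtain ⟨c, hc, hcf⟩ := ih
    have hdvd : (∏ i ∈ s, (X k - X i)) ∣ f k - c.eval (X k) := by
      refine prod_X_sub_X_dvd hk fun i hi => ?_
      have h1 := hf k i (by rintro rfl; exact hk hi)
      have h2 := Polynomial.sub_dvd_eval_sub (X k) (X i) c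
      rw [hcf i hi] at h2
      simpa using dvd_sub h1 h2
    obtain ⟨m, hm⟩ := hdvd
    refine ⟨c + Polynomial.C m * ∏ i ∈ s, (Polynomial.X - Polynomial.C (X i)), ?_, ?_⟩
    · rw [Finset.card_insert_of_notMem hk, Polynomial.mem_degreeLT] at *
      refine lt_of_le_of_lt (Polynomial.degree_add_le _ _) (max_lt ?_ ?_)
      · exact hc.trans (by exact_mod_cast Nat.lt_succ_self _)
      · refine lt_of_le_of_lt (Polynomial.degree_mul_le _ _) ?_
        rw [Polynomial.degree_prod]
        simp only [Polynomial.degree_X_sub_C, Finset.sum_const, nsmul_eq_mul, mul_one]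
        refine lt_of_le_of_lt (add_le_add_left Polynomial.degree_C_le _) ?_
        rw [zero_add]
        exact_mod_cast Nat.lt_succ_self _
    · intro i hi
      rw [Polynomial.eval_add, Polynomial.eval_mul, Polynomial.eval_C, Polynomial.eval_prod]
      simp only [Polynomial.eval_sub, Polynomial.eval_X, Polynomial.eval_C]
      rcases Finset.mem_insert.1 hi with rfl | hi
      · rw [mul_comm m, ← hm]; ring
      · rw [Finset.prod_eq_zero hi (sub_self _), hcf i hi, mul_zero, add_zero]

/-- The derivation module of the braid arrangement is free: its elements are uniquely
interpolated by polynomials of degree less than the number of variables. -/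
lemma projective_splines_top [Fintype ι] [DecidableEq ι] :
    Module.Projective (MvPolynomial ι ℚ) (splines (⊤ : SimpleGraph ι)) := by
  let ev : Polynomial.degreeLT (MvPolynomial ι ℚ) (Fintype.card ι) →ₗ[MvPolynomial ι ℚ]
      splines (⊤ : SimpleGraph ι) :=
    LinearMap.codRestrict _
      (LinearMap.pi fun i => Polynomial.leval (X i) ∘ₗ Submodule.subtype _)
      fun c i j _ => Polynomial.sub_dvd_eval_sub (X i) (X j) c.1
  have hev : Function.Bijective ev := by
    constructor
    · rw [injective_iff_map_eq_zero]
      rintro ⟨c, hc⟩ h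
      have h' : ∀ i, c.eval (X i) = 0 := fun i => congrFun (congrArg Subtype.val h) i
      refine Subtype.ext ?_
      by_contra hne
      exact hne (Polynomial.eq_zero_of_natDegree_lt_card_of_eval_eq_zero c
        (X_injective (R := ℚ)) h'
        ((Polynomial.natDegree_lt_iff_degree_lt hne).2 (Polynomial.mem_degreeLT.1 hc)))
    · rintro ⟨f, hf⟩
      obtain ⟨c, hc, hcf⟩ := exists_interpolation hf Finset.univ
      exact ⟨⟨c, hc⟩, Subtype.ext (funext fun i => hcf i (Finset.mem_univ i))⟩
  have : Module.Projective (MvPolynomial ι ℚ)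
      (Polynomial.degreeLT (MvPolynomial ι ℚ) (Fintype.card ι)) :=
    Module.Projective.of_equiv (Polynomial.degreeLTEquiv _ _).symm
  exact Module.Projective.of_equiv (LinearEquiv.ofBijective ev hev)

end Splines


section Cyclic

variable {ι : Type} [CommRing ι]

lemma ne_of_sub_eq {a b k : ι} (hk : k ≠ 0) (e : a - b = k) : a ≠ b :=
  sub_ne_zero.1 (e ▸ hk)

variable {G : SimpleGraph ι}

/-- The linear form `x_i - x_{i+1}` attached to an edge of the cycle. -/
noncomputable def cycForm (i : ι) : MvPolynomial ι ℚ := X i - X (i + 1)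

lemma cycForm_ne_zero (h : (1 : ι) ≠ 0) (i : ι) : cycForm i ≠ 0 :=
  X_sub_X_ne_zero (ne_of_sub_eq h (by ring)).symm

lemma mem_splines_top_iff (hG : ∀ i j, G.Adj i j ↔ i ≠ j ∧ j ≠ i + 1 ∧ i ≠ j + 1)
    {f : ι → MvPolynomial ι ℚ} :
    f ∈ splines (⊤ : SimpleGraph ι) ↔ f ∈ splines G ∧ ∀ i, cycForm i ∣ f i - f (i + 1) := by
  constructor
  · refine fun hf => ⟨splines_mono le_top hf, fun i => ?_⟩
    by_cases h : i = i + 1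
    · rw [← h, sub_self]; exact dvd_zero _
    · exact hf i (i + 1) h
  · rintro ⟨hf, hc⟩ i j hij
    by_cases h1 : j = i + 1
    · subst h1; exact hc i
    by_cases h2 : i = j + 1
    · subst h2
      have := hc j
      rw [cycForm] at this
      rw [← neg_sub, ← neg_sub (f j)]
      exact (neg_dvd.2 this).neg_right
    · exact hf i j ((hG i j).2 ⟨hij, h1, h2⟩)

variable [DecidableEq ι]

lemma cycForm_dvd_iff {i : ι} {f : MvPolynomial ι ℚ} :
    cycForm i ∣ f ↔ rename (merge i (i + 1)) f = 0 := X_sub_X_dvd_iff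

lemma rename_mergeTwo_of_cycForm_dvd {i : ι} {f : MvPolynomial ι ℚ} (h : cycForm i ∣ f) :
    rename (mergeTwo i (i - 1) (i + 1)) f = 0 := by
  obtain ⟨g, rfl⟩ := h
  rw [cycForm, map_mul, map_sub, rename_X, rename_X, mergeTwo_right, mergeTwo_self, sub_self,
    zero_mul]

lemma rename_mergeTwo_of_cycForm_pred_dvd {i : ι} {f : MvPolynomial ι ℚ}
    (h : cycForm (i - 1) ∣ f) : rename (mergeTwo i (i - 1) (i + 1)) f = 0 := by
  obtain ⟨g, rfl⟩ := h
  rw [cycForm, sub_add_cancel, map_mul, map_sub, rename_X, rename_X, mergeTwo_left,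
    mergeTwo_self, sub_self, zero_mul]

lemma exists_of_rename_mergeTwo_cycForm {i : ι} {f : MvPolynomial ι ℚ}
    (h : rename (mergeTwo i (i - 1) (i + 1)) f = 0) :
    ∃ u v, f = cycForm i * u + cycForm (i - 1) * v := by
  simpa only [cycForm, sub_add_cancel] using exists_of_rename_mergeTwo_eq_zero h

lemma rename_mergeTwo_cycForm_succ (h : (1 : ι) ≠ 0 ∧ (2 : ι) ≠ 0 ∧ (3 : ι) ≠ 0 ∧ (4 : ι) ≠ 0)
    (i : ι) :
    rename (mergeTwo i (i - 1) (i + 1)) (cycForm (i + 1)) = X i - X (i + 2) := by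
  rw [cycForm, map_sub, rename_X, rename_X, mergeTwo_right,
    mergeTwo_of_ne (ne_of_sub_eq h.2.2.1 (by ring)) (ne_of_sub_eq h.1 (by ring))]
  ring_nf

lemma rename_mergeTwo_cycForm_pred (h : (1 : ι) ≠ 0 ∧ (2 : ι) ≠ 0 ∧ (3 : ι) ≠ 0 ∧ (4 : ι) ≠ 0)
    (i : ι) :
    rename (mergeTwo i (i - 1) (i + 1)) (cycForm (i - 2)) = X (i - 2) - X i := by
  have e : i - 2 + 1 = i - 1 := by ring
  rw [cycForm, e, map_sub, rename_X, rename_X, mergeTwo_left,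
    mergeTwo_of_ne ((ne_of_sub_eq h.1 (by ring)).symm) ((ne_of_sub_eq h.2.2.1 (by ring)).symm)]

lemma rename_merge_cycForm_succ (h : (1 : ι) ≠ 0 ∧ (2 : ι) ≠ 0 ∧ (3 : ι) ≠ 0 ∧ (4 : ι) ≠ 0)
    (i : ι) :
    rename (merge i (i + 1)) (cycForm (i + 1)) = X i - X (i + 2) := by
  rw [cycForm, map_sub, rename_X, rename_X, merge_self, merge_of_ne (ne_of_sub_eq h.1 (by ring))]
  ring_nf

lemma rename_merge_cycForm_pred (h : (1 : ι) ≠ 0 ∧ (2 : ι) ≠ 0 ∧ (3 : ι) ≠ 0 ∧ (4 : ι) ≠ 0)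
    (i : ι) :
    rename (merge i (i + 1)) (cycForm (i - 1)) = X (i - 1) - X i := by
  rw [cycForm, sub_add_cancel, map_sub, rename_X, rename_X, merge_left,
    merge_of_ne ((ne_of_sub_eq h.2.1 (by ring)).symm)]

lemma cycForm_dvd_of_dvd_pred_mul
    (h : (1 : ι) ≠ 0 ∧ (2 : ι) ≠ 0 ∧ (3 : ι) ≠ 0 ∧ (4 : ι) ≠ 0) {i : ι} {f : MvPolynomial ι ℚ}
    (hf : cycForm i ∣ cycForm (i - 1) * f) : cycForm i ∣ f := by
  rw [cycForm_dvd_iff, map_mul, rename_merge_cycForm_pred h] at hf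
  rw [cycForm_dvd_iff]
  exact (mul_eq_zero.1 hf).resolve_left (X_sub_X_ne_zero ((ne_of_sub_eq h.1 (by ring)).symm))

lemma cycForm_dvd_of_dvd_succ_mul
    (h : (1 : ι) ≠ 0 ∧ (2 : ι) ≠ 0 ∧ (3 : ι) ≠ 0 ∧ (4 : ι) ≠ 0) {i : ι} {f : MvPolynomial ι ℚ}
    (hf : cycForm i ∣ cycForm (i + 1) * f) : cycForm i ∣ f := by
  rw [cycForm_dvd_iff, map_mul, rename_merge_cycForm_succ h] at hf
  rw [cycForm_dvd_iff]
  exact (mul_eq_zero.1 hf).resolve_left (X_sub_X_ne_zero ((ne_of_sub_eq h.2.1 (by ring)).symm))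

variable [Fintype ι]

/-- The product of the forms `x_i - x_j` over the antihole neighbours `j` of `i`. -/
noncomputable def vertexProd (i : ι) : MvPolynomial ι ℚ := coProd {i - 1, i, i + 1} i

/-- The product of the forms `x_i - x_j` over the common antihole neighbours of `i` and `i + 1`. -/
noncomputable def edgeProd (i : ι) : MvPolynomial ι ℚ := coProd {i - 1, i, i + 1, i + 2} i

lemma edgeProd_ne_zero (i : ι) : edgeProd i ≠ 0 := coProd_ne_zero (by simp)

lemma rename_merge_edgeProd (i : ι) :
    rename (merge i (i + 1)) (edgeProd i) = edgeProd i := by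
  rw [edgeProd, rename_coProd (fun j hj => merge_of_ne ?_), merge_left]
  rintro rfl
  simp at hj

lemma rename_merge_vertexProd (h : (1 : ι) ≠ 0 ∧ (2 : ι) ≠ 0 ∧ (3 : ι) ≠ 0 ∧ (4 : ι) ≠ 0) (i : ι) :
    rename (merge i (i + 1)) (vertexProd i) = edgeProd i * (X i - X (i + 2)) := by
  have e : vertexProd i = (X i - X (i + 2)) * edgeProd i := by
    rw [vertexProd, coProd_eq_mul (j := i + 2) (by
      simp only [Finset.mem_insert, Finset.mem_singleton, not_or]
      exact ⟨ne_of_sub_eq h.2.2.1 (by ring), ne_of_sub_eq h.2.1 (by ring),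
        ne_of_sub_eq h.1 (by ring)⟩), edgeProd]
    congr 2
    ext j; simp; tauto
  rw [e, map_mul, rename_merge_edgeProd, map_sub, rename_X, rename_X, merge_left,
    merge_of_ne (ne_of_sub_eq h.1 (by ring)), mul_comm]

lemma rename_merge_vertexProd_succ
    (h : (1 : ι) ≠ 0 ∧ (2 : ι) ≠ 0 ∧ (3 : ι) ≠ 0 ∧ (4 : ι) ≠ 0) (i : ι) :
    rename (merge i (i + 1)) (vertexProd (i + 1)) = edgeProd i * (X i - X (i - 1)) := by
  have e : insert (i - 1) {i + 1 - 1, i + 1, i + 1 + 1} =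
      ({i - 1, i, i + 1, i + 2} : Finset ι) := by
    have : i + 1 + 1 = i + 2 := by ring
    simp [this]
  rw [vertexProd, coProd_eq_mul (j := i - 1) (by
      simp only [Finset.mem_insert, Finset.mem_singleton, not_or]
      exact ⟨(ne_of_sub_eq h.1 (by ring)).symm, (ne_of_sub_eq h.2.1 (by ring)).symm,
          (ne_of_sub_eq h.2.2.1 (by ring)).symm⟩), e, map_mul,
    rename_coProd (fun j hj => merge_of_ne (by rintro rfl; simp at hj)), merge_self, map_sub,
    rename_X, rename_X, merge_self, merge_of_ne ((ne_of_sub_eq h.2.1 (by ring)).symm), mul_comm,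
    edgeProd]

lemma rename_mergeTwo_edgeProd
    (h : (1 : ι) ≠ 0 ∧ (2 : ι) ≠ 0 ∧ (3 : ι) ≠ 0 ∧ (4 : ι) ≠ 0) (i : ι) :
    rename (mergeTwo i (i - 1) (i + 1)) (edgeProd i) =
      (X i - X (i - 2)) * coProd {i - 2, i - 1, i, i + 1, i + 2} i := by
  rw [edgeProd, rename_coProd, mergeTwo_self, coProd_eq_mul (j := i - 2)]
  · simp only [Finset.mem_insert, Finset.mem_singleton, not_or]
    exact ⟨(ne_of_sub_eq h.1 (by ring)).symm, (ne_of_sub_eq h.2.1 (by ring)).symm,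
        (ne_of_sub_eq h.2.2.1 (by ring)).symm, (ne_of_sub_eq h.2.2.2 (by ring)).symm⟩
  · intro j hj
    exact mergeTwo_of_ne (by rintro rfl; simp at hj) (by rintro rfl; simp at hj)

lemma rename_mergeTwo_edgeProd_pred
    (h : (1 : ι) ≠ 0 ∧ (2 : ι) ≠ 0 ∧ (3 : ι) ≠ 0 ∧ (4 : ι) ≠ 0) (i : ι) :
    rename (mergeTwo i (i - 1) (i + 1)) (edgeProd (i - 1)) =
      (X i - X (i + 2)) * coProd {i - 2, i - 1, i, i + 1, i + 2} i := by
  have e : ({i - 1 - 1, i - 1, i - 1 + 1, i - 1 + 2} : Finset ι) = {i - 2, i - 1, i, i + 1} := by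
    have h1 : i - 1 - 1 = i - 2 := by ring
    have h2 : i - 1 + 2 = i + 1 := by ring
    simp [h1, h2]
  rw [edgeProd, e, rename_coProd, mergeTwo_left, coProd_eq_mul (j := i + 2)]
  · congr 2
    ext j; simp; tauto
  · simp only [Finset.mem_insert, Finset.mem_singleton, not_or]
    exact ⟨ne_of_sub_eq h.2.2.2 (by ring), ne_of_sub_eq h.2.2.1 (by ring),
      ne_of_sub_eq h.2.1 (by ring), ne_of_sub_eq h.1 (by ring)⟩
  · intro j hj
    exact mergeTwo_of_ne (by rintro rfl; simp at hj) (by rintro rfl; simp at hj)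

lemma exists_edgeProd_mul
    (hG : ∀ i j, G.Adj i j ↔ i ≠ j ∧ j ≠ i + 1 ∧ i ≠ j + 1)
    {f : ι → MvPolynomial ι ℚ} (hf : f ∈ splines G) (i : ι) :
    ∃ g, cycForm i ∣ f i - f (i + 1) - edgeProd i * g := by
  have hdvd : edgeProd i ∣ rename (merge i (i + 1)) (f i - f (i + 1)) := by
    refine prod_X_sub_X_dvd (by simp) fun j hj => ?_
    simp only [Finset.mem_compl, Finset.mem_insert, Finset.mem_singleton, not_or] at hj
    have h1 := map_dvd (rename (merge i (i + 1))) (hf i j ((hG i j).2 ⟨Ne.symm hj.2.1, hj.2.2.1,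
        fun e => hj.1 (by rw [e, add_sub_cancel_right])⟩))
    have h2 := map_dvd (rename (merge i (i + 1))) (hf (i + 1) j ((hG _ j).2 ⟨Ne.symm hj.2.2.1,
        fun e => hj.2.2.2 (by rw [e]; ring), fun e => hj.2.1 (add_right_cancel e).symm⟩))
    simp only [map_sub, rename_X, merge_left, merge_self, merge_of_ne hj.2.2.1] at h1 h2 ⊢
    simpa using dvd_sub h1 h2
  obtain ⟨g, hg⟩ := hdvd
  refine ⟨g, ?_⟩
  have := rename_merge_idem i (i + 1) (f i - f (i + 1))
  rw [cycForm_dvd_iff, map_sub, ← this, hg, map_mul, rename_merge_edgeProd, sub_self]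

lemma exists_vertex_coeff (h : (1 : ι) ≠ 0 ∧ (2 : ι) ≠ 0 ∧ (3 : ι) ≠ 0 ∧ (4 : ι) ≠ 0)
    (hG : ∀ i j, G.Adj i j ↔ i ≠ j ∧ j ≠ i + 1 ∧ i ≠ j + 1)
    {f g : ι → MvPolynomial ι ℚ} (hf : f ∈ splines G)
    (hg : ∀ i, cycForm i ∣ f i - f (i + 1) - edgeProd i * g i) (i : ι) :
    ∃ b, rename (mergeTwo i (i - 1) (i + 1)) (g i - cycForm (i + 1) * b) = 0 ∧
      rename (mergeTwo i (i - 1) (i + 1)) (g (i - 1) - cycForm (i - 2) * b) = 0 := by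
  have e1 := rename_mergeTwo_of_cycForm_dvd (hg i)
  have e2 := rename_mergeTwo_of_cycForm_pred_dvd (hg (i - 1))
  have e3 : rename (mergeTwo i (i - 1) (i + 1)) (f (i - 1) - f (i + 1)) = 0 := by
    obtain ⟨w, hw⟩ := hf (i - 1) (i + 1) ((hG _ _).2 ⟨(ne_of_sub_eq h.2.1 (by ring)).symm,
        ne_of_sub_eq h.1 (by ring), (ne_of_sub_eq h.2.2.1 (by ring)).symm⟩)
    rw [hw, map_mul, map_sub, rename_X, rename_X, mergeTwo_left, mergeTwo_right, sub_self, zero_mul]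
  rw [sub_add_cancel] at e2
  simp only [map_sub, map_mul, rename_mergeTwo_edgeProd h, rename_mergeTwo_edgeProd_pred h]
    at e1 e2 e3
  have hQ : coProd {i - 2, i - 1, i, i + 1, i + 2} i ≠ 0 := coProd_ne_zero (by simp)
  have key : (X i - X (i + 2)) * rename (mergeTwo i (i - 1) (i + 1)) (g (i - 1)) =
      (X (i - 2) - X i) * rename (mergeTwo i (i - 1) (i + 1)) (g i) := by
    refine mul_left_cancel₀ hQ ?_
    linear_combination e3 - e1 - e2
  have hne : i ≠ i + 2 := (ne_of_sub_eq h.2.1 (by ring)).symm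
  have hdvd : (X i - X (i + 2)) ∣ rename (mergeTwo i (i - 1) (i + 1)) (g i) := by
    refine X_sub_X_dvd_of_mul_left hne (not_X_sub_X_dvd (k := i - 2) (l := i) ?_) ⟨_, key.symm⟩
    rw [merge_left, merge_of_ne ((ne_of_sub_eq h.2.2.2 (by ring)).symm)]
    exact (ne_of_sub_eq h.2.1 (by ring)).symm
  obtain ⟨b, hb⟩ := hdvd
  have hb' : rename (mergeTwo i (i - 1) (i + 1)) (g (i - 1)) = (X (i - 2) - X i) * b := by
    refine mul_left_cancel₀ (X_sub_X_ne_zero hne) ?_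
    rw [key, hb]; ring
  have i1 := rename_mergeTwo_idem i (i - 1) (i + 1) (g i)
  have i2 := rename_mergeTwo_idem i (i - 1) (i + 1) (g (i - 1))
  rw [hb] at i1
  rw [hb'] at i2
  simp only [map_sub, map_mul, rename_X, mergeTwo_self] at i1 i2
  rw [mergeTwo_of_ne (ne_of_sub_eq h.2.2.1 (by ring)) (ne_of_sub_eq h.1 (by ring))] at i1
  rw [mergeTwo_of_ne ((ne_of_sub_eq h.1 (by ring)).symm)
    ((ne_of_sub_eq h.2.2.1 (by ring)).symm)] at i2
  refine ⟨b, ?_, ?_⟩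
  · rw [map_sub, map_mul, rename_mergeTwo_cycForm_succ h, hb, i1, sub_self]
  · rw [map_sub, map_mul, rename_mergeTwo_cycForm_pred h, hb', i2, sub_self]

lemma cycForm_dvd_mul_vertexProd_iff
    (h : (1 : ι) ≠ 0 ∧ (2 : ι) ≠ 0 ∧ (3 : ι) ≠ 0 ∧ (4 : ι) ≠ 0) (g a b : MvPolynomial ι ℚ) (i : ι) :
    cycForm i ∣ edgeProd i * g - (a * vertexProd i - b * vertexProd (i + 1)) ↔
      cycForm i ∣ g - (a * cycForm (i + 1) + b * cycForm (i - 1)) := by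
  have key : rename (merge i (i + 1))
        (edgeProd i * g - (a * vertexProd i - b * vertexProd (i + 1))) =
      edgeProd i * rename (merge i (i + 1))
        (g - (a * cycForm (i + 1) + b * cycForm (i - 1))) := by
    simp only [map_sub, map_add, map_mul, rename_merge_vertexProd h, rename_merge_edgeProd,
      rename_merge_vertexProd_succ h, rename_merge_cycForm_succ h, rename_merge_cycForm_pred h]
    ring
  rw [cycForm_dvd_iff, cycForm_dvd_iff, key, mul_eq_zero, or_iff_right (edgeProd_ne_zero i)]

/-- Modulo the braid derivations, a logarithmic derivation of the antihole is a combination of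
the derivations supported at a single vertex. -/
lemma exists_sub_vertexProd_mem (h : (1 : ι) ≠ 0 ∧ (2 : ι) ≠ 0 ∧ (3 : ι) ≠ 0 ∧ (4 : ι) ≠ 0)
    (hG : ∀ i j, G.Adj i j ↔ i ≠ j ∧ j ≠ i + 1 ∧ i ≠ j + 1)
    {f : ι → MvPolynomial ι ℚ} (hf : f ∈ splines G) :
    ∃ a : ι → MvPolynomial ι ℚ,
      ∀ i, cycForm i ∣
        (f i - a i * vertexProd i) - (f (i + 1) - a (i + 1) * vertexProd (i + 1)) := by
  choose g hg using exists_edgeProd_mul hG hf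
  choose b hb hb' using exists_vertex_coeff h hG hf hg
  have hr : ∀ i, ∃ m, cycForm i ∣
      g i - cycForm (i + 1) * b i - cycForm (i - 1) * b (i + 1) -
        cycForm (i - 1) * (cycForm (i + 1) * m) := by
    intro i
    obtain ⟨u, v, huv⟩ := exists_of_rename_mergeTwo_cycForm (hb i)
    obtain ⟨u', v', huv'⟩ := exists_of_rename_mergeTwo_cycForm (hb' (i + 1))
    have e1 : i + 1 - 2 = i - 1 := by ring
    rw [add_sub_cancel_right, e1] at huv'
    have h3 : rename (mergeTwo (i + 1) (i + 1 - 1) (i + 1 + 1)) (v - b (i + 1)) = 0 := by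
      have h4 : rename (mergeTwo (i + 1) (i + 1 - 1) (i + 1 + 1))
          (cycForm (i + 1 - 2) * (v - b (i + 1))) = 0 := by
        have : cycForm (i + 1 - 2) * (v - b (i + 1)) =
            cycForm (i + 1) * (u' - b i) + cycForm (i + 1 - 1) * (v' - u) := by
          rw [add_sub_cancel_right, e1]
          linear_combination huv' - huv
        rw [this, map_add, rename_mergeTwo_of_cycForm_dvd (dvd_mul_right _ _),
          rename_mergeTwo_of_cycForm_pred_dvd (dvd_mul_right _ _), add_zero]
      rw [map_mul, rename_mergeTwo_cycForm_pred h] at h4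
      exact (mul_eq_zero.1 h4).resolve_left (X_sub_X_ne_zero ((ne_of_sub_eq h.2.1 (by ring)).symm))
    obtain ⟨m, n, hmn⟩ := exists_of_rename_mergeTwo_cycForm h3
    rw [add_sub_cancel_right] at hmn
    exact ⟨m, u + cycForm (i - 1) * n, by linear_combination huv + cycForm (i - 1) * hmn⟩
  choose m hm using hr
  refine ⟨fun i => b i + cycForm (i - 1) * m i, fun i => ?_⟩
  have h1 := (cycForm_dvd_mul_vertexProd_iff h (g i) (b i + cycForm (i - 1) * m i)
    (b (i + 1) + cycForm i * m (i + 1)) i).2 (by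
      have := dvd_sub (hm i) (dvd_mul_right (cycForm i) (m (i + 1) * cycForm (i - 1)))
      convert this using 1
      ring)
  have := dvd_add (hg i) h1
  convert this using 1
  simp only [add_sub_cancel_right]
  ring

end Cyclic

section Resolution

variable {ι : Type} [CommRing ι]

/-- The first syzygies of the logarithmic derivations of the antihole supported at vertices,
modulo the braid derivations. -/
noncomputable def cycSyzygies (ι : Type) [CommRing ι] :
    Submodule (MvPolynomial ι ℚ) (ι → MvPolynomial ι ℚ) where
  carrier := {a | ∀ i, cycForm i ∣ a i * cycForm (i + 1) + a (i + 1) * cycForm (i - 1)}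
  add_mem' {a b} ha hb i := by
    have := dvd_add (ha i) (hb i)
    convert this using 1
    simp only [Pi.add_apply]
    ring
  zero_mem' i := by simp
  smul_mem' c a ha i := by
    have := (ha i).mul_left c
    convert this using 1
    simp only [Pi.smul_apply, smul_eq_mul]
    ring

/-- The second differential of the resolution. -/
noncomputable def cycDiff (ι : Type) [CommRing ι] :
    (ι → MvPolynomial ι ℚ) →ₗ[MvPolynomial ι ℚ]
      (ι → MvPolynomial ι ℚ) × (ι → MvPolynomial ι ℚ) where
  toFun s := (fun i => -cycForm i * s i, fun i => s i - s (i - 1))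
  map_add' _ _ := Prod.ext (funext fun _ => mul_add _ _ _)
    (funext fun _ => add_sub_add_comm _ _ _ _)
  map_smul' _ _ := Prod.ext (funext fun _ => mul_left_comm _ _ _)
    (funext fun _ => (mul_sub _ _ _).symm)

lemma cycDiff_apply (s : ι → MvPolynomial ι ℚ) :
    cycDiff ι s = (fun i => -cycForm i * s i, fun i => s i - s (i - 1)) := rfl

/-- The presentation of the syzygy module. -/
noncomputable def cycCover (ι : Type) [CommRing ι] :
    (ι → MvPolynomial ι ℚ) × (ι → MvPolynomial ι ℚ) →ₗ[MvPolynomial ι ℚ] cycSyzygies ι :=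
  LinearMap.codRestrict _
    (LinearMap.pi fun i =>
      cycForm i • (cycForm (i - 1) • LinearMap.proj i ∘ₗ LinearMap.snd _ _ _ -
        LinearMap.proj (i - 1) ∘ₗ LinearMap.fst _ _ _) +
      cycForm (i - 1) • LinearMap.proj i ∘ₗ LinearMap.fst _ _ _)
    fun x i => by
      refine ⟨(cycForm (i - 1) * x.2 i - x.1 (i - 1)) * cycForm (i + 1) +
        (cycForm (i + 1) * x.2 (i + 1) + x.1 (i + 1)) * cycForm (i - 1), ?_⟩
      simp
      ring

lemma cycCover_apply (x : (ι → MvPolynomial ι ℚ) × (ι → MvPolynomial ι ℚ)) (i : ι) :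
    (cycCover ι x : ι → MvPolynomial ι ℚ) i =
      cycForm i * (cycForm (i - 1) * x.2 i - x.1 (i - 1)) + cycForm (i - 1) * x.1 i := rfl

lemma cycDiff_injective (h : (1 : ι) ≠ 0) : Function.Injective (cycDiff ι) := by
  intro s t hst
  funext i
  rw [cycDiff_apply, cycDiff_apply] at hst
  exact mul_left_cancel₀ (neg_ne_zero.2 (cycForm_ne_zero h i)) (congrFun (congrArg Prod.fst hst) i)

/-- The second differential is minimal, so it does not split. -/
lemma not_exists_retraction_cycDiff [Finite ι] :
    ¬ ∃ r : (ι → MvPolynomial ι ℚ) × (ι → MvPolynomial ι ℚ) →ₗ[MvPolynomial ι ℚ]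
      (ι → MvPolynomial ι ℚ), r ∘ₗ cycDiff ι = LinearMap.id := by
  classical
  have := Fintype.ofFinite ι
  rintro ⟨r, hr⟩
  have h1 := congrFun (LinearMap.congr_fun hr fun _ => 1) 0
  have h2 : cycDiff ι (fun _ => 1) =
      LinearMap.inl (MvPolynomial ι ℚ) _ (ι → MvPolynomial ι ℚ) fun i => -cycForm i := by
    simp only [cycDiff_apply, mul_one, sub_self]
    rfl
  rw [LinearMap.comp_apply, h2, ← LinearMap.comp_apply, LinearMap.pi_apply_eq_sum_univ,
    Finset.sum_apply] at h1
  have h3 := congrArg constantCoeff h1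
  simp [cycForm] at h3

variable [DecidableEq ι]

lemma exact_cycDiff_cycCover (h : (1 : ι) ≠ 0 ∧ (2 : ι) ≠ 0 ∧ (3 : ι) ≠ 0 ∧ (4 : ι) ≠ 0) :
    Function.Exact (cycDiff ι) (cycCover ι) := by
  intro x
  constructor
  · intro hx
    have hx' : ∀ i, cycForm i * (cycForm (i - 1) * x.2 i - x.1 (i - 1)) +
        cycForm (i - 1) * x.1 i = 0 :=
      fun i => congrFun (congrArg Subtype.val hx) i
    have hs : ∀ i, cycForm i ∣ x.1 i := fun i => by
      refine cycForm_dvd_of_dvd_pred_mul h ⟨-(cycForm (i - 1) * x.2 i - x.1 (i - 1)), ?_⟩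
      linear_combination hx' i
    choose s hs using hs
    refine ⟨fun i => -s i, ?_⟩
    rw [cycDiff_apply]
    refine Prod.ext (funext fun i => ?_) (funext fun i => ?_)
    · rw [hs i]; ring
    · refine mul_left_cancel₀ (mul_ne_zero (cycForm_ne_zero h.1 i) (cycForm_ne_zero h.1 (i - 1))) ?_
      have := hx' i
      rw [hs i, hs (i - 1)] at this
      linear_combination -this
  · rintro ⟨s, rfl⟩
    refine Subtype.ext (funext fun i => ?_)
    rw [cycCover_apply, cycDiff_apply]
    simp only [ZeroMemClass.coe_zero, Pi.zero_apply]
    ring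

lemma cycCover_surjective (h : (1 : ι) ≠ 0 ∧ (2 : ι) ≠ 0 ∧ (3 : ι) ≠ 0 ∧ (4 : ι) ≠ 0) :
    Function.Surjective (cycCover ι) := by
  rintro ⟨a, ha⟩
  have huv : ∀ i, ∃ u v, a i = cycForm i * u + cycForm (i - 1) * v := by
    intro i
    refine exists_of_rename_mergeTwo_cycForm ?_
    have h1 := rename_mergeTwo_of_cycForm_dvd (ha i)
    have h2 : rename (mergeTwo i (i - 1) (i + 1)) (cycForm (i - 1)) = 0 :=
      rename_mergeTwo_of_cycForm_pred_dvd dvd_rfl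
    rw [map_add, map_mul, map_mul, h2, mul_zero, add_zero, rename_mergeTwo_cycForm_succ h] at h1
    exact (mul_eq_zero.1 h1).resolve_right (X_sub_X_ne_zero (ne_of_sub_eq h.2.1 (by ring)).symm)
  choose u v huv using huv
  have hw : ∀ i, cycForm i ∣ v i + u (i + 1) := by
    intro i
    refine cycForm_dvd_of_dvd_pred_mul h (cycForm_dvd_of_dvd_succ_mul h ?_)
    have h1 := dvd_sub (ha i) (dvd_mul_right (cycForm i)
      (u i * cycForm (i + 1) + v (i + 1) * cycForm (i - 1)))
    convert h1 using 1
    rw [huv i, huv (i + 1), add_sub_cancel_right]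
    ring
  choose w hw using hw
  refine ⟨(v, fun i => w (i - 1)), Subtype.ext (funext fun i => ?_)⟩
  have := hw (i - 1)
  rw [sub_add_cancel] at this
  rw [cycCover_apply]
  simp only
  rw [huv i]
  linear_combination -cycForm i * this

variable [Fintype ι] {G : SimpleGraph ι}

lemma mul_vertexProd_mem_splines (hG : ∀ i j, G.Adj i j ↔ i ≠ j ∧ j ≠ i + 1 ∧ i ≠ j + 1)
    (a : ι → MvPolynomial ι ℚ) : (fun i => a i * vertexProd i) ∈ splines G := by
  have key : ∀ i j, G.Adj i j → (X i - X j) ∣ a i * vertexProd i := by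
    intro i j hij
    obtain ⟨h1, h2, h3⟩ := (hG i j).1 hij
    refine (X_sub_X_dvd_coProd ?_ i).mul_left _
    simp only [Finset.mem_insert, Finset.mem_singleton, not_or]
    exact ⟨fun e => h3 (by rw [e, sub_add_cancel]), h1.symm, h2⟩
  intro i j hij
  refine dvd_sub (key i j hij) ?_
  rw [← neg_sub]
  exact neg_dvd.2 (key j i hij.symm)

/-- The generators of the logarithmic derivations of the antihole. -/
noncomputable def splinesCover (hG : ∀ i j, G.Adj i j ↔ i ≠ j ∧ j ≠ i + 1 ∧ i ≠ j + 1) :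
    splines (⊤ : SimpleGraph ι) × (ι → MvPolynomial ι ℚ) →ₗ[MvPolynomial ι ℚ] splines G :=
  (Submodule.inclusion (splines_mono le_top)).coprod
    (LinearMap.codRestrict _ (LinearMap.pi fun i => vertexProd i • LinearMap.proj i) fun a => by
      have := mul_vertexProd_mem_splines hG a
      convert this using 2 with i
      exact mul_comm _ _)

lemma splinesCover_apply (hG : ∀ i j, G.Adj i j ↔ i ≠ j ∧ j ≠ i + 1 ∧ i ≠ j + 1)
    (x : splines (⊤ : SimpleGraph ι) × (ι → MvPolynomial ι ℚ)) (i : ι) :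
    (splinesCover hG x : ι → MvPolynomial ι ℚ) i =
      (x.1 : ι → MvPolynomial ι ℚ) i + vertexProd i * x.2 i := rfl

lemma splinesCover_surjective (h : (1 : ι) ≠ 0 ∧ (2 : ι) ≠ 0 ∧ (3 : ι) ≠ 0 ∧ (4 : ι) ≠ 0)
    (hG : ∀ i j, G.Adj i j ↔ i ≠ j ∧ j ≠ i + 1 ∧ i ≠ j + 1) :
    Function.Surjective (splinesCover hG) := by
  rintro ⟨f, hf⟩
  obtain ⟨a, ha⟩ := exists_sub_vertexProd_mem h hG hf
  refine ⟨(⟨f - fun i => a i * vertexProd i, (mem_splines_top_iff hG).2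
    ⟨sub_mem hf (mul_vertexProd_mem_splines hG a), ha⟩⟩, a), Subtype.ext (funext fun i => ?_)⟩
  rw [splinesCover_apply]
  simp only [Pi.sub_apply]
  ring

lemma mem_cycSyzygies_iff (h : (1 : ι) ≠ 0 ∧ (2 : ι) ≠ 0 ∧ (3 : ι) ≠ 0 ∧ (4 : ι) ≠ 0)
    (hG : ∀ i j, G.Adj i j ↔ i ≠ j ∧ j ≠ i + 1 ∧ i ≠ j + 1) (a : ι → MvPolynomial ι ℚ) :
    a ∈ cycSyzygies ι ↔ (fun i => -(vertexProd i * a i)) ∈ splines (⊤ : SimpleGraph ι) := by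
  have hmem : (fun i => -(vertexProd i * a i)) ∈ splines G := by
    convert mul_vertexProd_mem_splines hG (-a) using 2 with i
    simp only [Pi.neg_apply]
    ring
  rw [mem_splines_top_iff hG, and_iff_right hmem]
  refine forall_congr' fun i => ?_
  have := cycForm_dvd_mul_vertexProd_iff h 0 (a i) (a (i + 1)) i
  rw [zero_sub, dvd_neg] at this
  rw [← this]
  ring_nf

/-- The first differential of the resolution. -/
noncomputable def syzygyInclusion
    (h : (1 : ι) ≠ 0 ∧ (2 : ι) ≠ 0 ∧ (3 : ι) ≠ 0 ∧ (4 : ι) ≠ 0)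
    (hG : ∀ i j, G.Adj i j ↔ i ≠ j ∧ j ≠ i + 1 ∧ i ≠ j + 1) :
    cycSyzygies ι →ₗ[MvPolynomial ι ℚ] splines (⊤ : SimpleGraph ι) × (ι → MvPolynomial ι ℚ) where
  toFun a := (⟨fun i => -(vertexProd i * a.1 i), (mem_cycSyzygies_iff h hG a.1).1 a.2⟩, a.1)
  map_add' a b := Prod.ext (Subtype.ext (funext fun i => by
    simp only [Submodule.coe_add, Prod.fst_add, Pi.add_apply]
    ring)) rfl
  map_smul' c a := Prod.ext (Subtype.ext (funext fun i => by
    simp only [Submodule.coe_smul, Prod.smul_fst, Pi.smul_apply, smul_eq_mul, RingHom.id_apply]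
    ring)) rfl

lemma exact_syzygyInclusion_splinesCover
    (h : (1 : ι) ≠ 0 ∧ (2 : ι) ≠ 0 ∧ (3 : ι) ≠ 0 ∧ (4 : ι) ≠ 0)
    (hG : ∀ i j, G.Adj i j ↔ i ≠ j ∧ j ≠ i + 1 ∧ i ≠ j + 1) :
    Function.Exact (syzygyInclusion h hG) (splinesCover hG) := by
  rintro ⟨⟨f, hf⟩, a⟩
  constructor
  · intro hx
    have hx' : ∀ i, f i = -(vertexProd i * a i) := fun i =>
      eq_neg_of_add_eq_zero_left (congrFun (congrArg Subtype.val hx) i)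
    have ha : a ∈ cycSyzygies ι := (mem_cycSyzygies_iff h hG a).2 (funext hx' ▸ hf)
    exact ⟨⟨a, ha⟩, Prod.ext (Subtype.ext (funext fun i => (hx' i).symm)) rfl⟩
  · rintro ⟨b, hb⟩
    rw [← hb]
    exact Subtype.ext (funext fun i => neg_add_cancel _)

lemma pd_eq_two_of_equiv_splines (h : (1 : ι) ≠ 0 ∧ (2 : ι) ≠ 0 ∧ (3 : ι) ≠ 0 ∧ (4 : ι) ≠ 0)
    (hG : ∀ i j, G.Adj i j ↔ i ≠ j ∧ j ≠ i + 1 ∧ i ≠ j + 1)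
    {M : Type} [AddCommGroup M] [Module (MvPolynomial ι ℚ) M]
    (E : splines G ≃ₗ[MvPolynomial ι ℚ] M) : pd (ModuleCat.of (MvPolynomial ι ℚ) M) = 2 := by
  have := projective_splines_top (ι := ι)
  refine pd_eq_two_of_exact (cycDiff ι) (cycCover ι) (syzygyInclusion h hG)
    (E.toLinearMap ∘ₗ splinesCover hG) (cycDiff_injective h.1) (cycCover_surjective h)
    (exact_cycDiff_cycCover h) (fun a b hab => Subtype.ext (congrArg Prod.snd hab))
    (E.surjective.comp (splinesCover_surjective h hG)) (fun x => ?_) not_exists_retraction_cycDiff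
  rw [← exact_syzygyInclusion_splinesCover h hG x]
  exact E.map_eq_zero_iff

end Resolution

/-- A derivation is determined by its values on the variables. -/
noncomputable def splinesEquivLogDer (ℓ : ℕ) (G : SimpleGraph (Fin ℓ)) :
    splines G ≃ₗ[Spoly ℓ] logDer ℓ G where
  toFun f := ⟨mkDerivation ℚ f, fun i j hij => by simpa only [mkDerivation_X] using f.2 i j hij⟩
  invFun θ := ⟨fun i => θ.1 (X i), θ.2⟩
  map_add' f g := Subtype.ext (derivation_ext fun i => by
    simp [mkDerivation_X])
  map_smul' c f := Subtype.ext (derivation_ext fun i => by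
    simp [mkDerivation_X])
  left_inv f := Subtype.ext (funext fun i => mkDerivation_X _ _ _)
  right_inv θ := Subtype.ext (derivation_ext fun i => mkDerivation_X _ _ _)

open Fin.CommRing in
/-- For `ℓ ≥ 6` the projective dimension of the derivation module of the graphic
arrangement of the `ℓ`-antihole (the complement of the `ℓ`-cycle) equals 2. -/
theorem pd_antihole_eq_two (ℓ : ℕ) (hℓ : 6 ≤ ℓ) :
    pd (ModuleCat.of (Spoly ℓ) (logDer ℓ ((SimpleGraph.cycleGraph ℓ)ᶜ))) = 2 := by
  obtain ⟨n, rfl⟩ := Nat.exists_eq_add_of_le' hℓ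
  refine pd_eq_two_of_equiv_splines ?_ (fun i j => ?_) (splinesEquivLogDer _ _)
  · have h : ∀ k : ℕ, 0 < k → k < n + 6 → (k : Fin (n + 6)) ≠ 0 := fun k hk hkn e => by
      rw [Fin.natCast_eq_zero] at e
      exact absurd (Nat.le_of_dvd hk e) (by omega)
    exact ⟨by simp, h 2 (by omega) (by omega),
      h 3 (by omega) (by omega), h 4 (by omega) (by omega)⟩
  · rw [SimpleGraph.compl_adj, SimpleGraph.cycleGraph_adj, not_or, sub_eq_iff_eq_add',
      sub_eq_iff_eq_add']
    tauto
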